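/- Let ν ∈ [0,1/2], let χ₁, χ₂, χ₃ ∈ C_c^∞(ℝ) with supp χ₁ ∩ supp χ₂ = ∅ and supp χ₂ ∩ supp χ₃ = ∅, and let q ∈ C_c^∞(ℝ²). For h ∈ (0,1] set s := 1/2 − ν + i/h and define, for x, ξ ∈ ℝ, b(x,ξ;h) := e^{−ixξ/h} · χ₁(x) · [B(s)( χ₂ · B(1−s)( χ₃ · q(·,ξ) · e^{i(·)ξ/h} ) )](x); here the inner operator B(1−s) applied to the bounded compactly supported function χ₃·q(·,ξ)e^{i(·)ξ/h} is evaluated only on supp χ₂, where its defining integral converges absolutely since supp χ₂ ∩ supp χ₃ = ∅, and the outer integral converges absolutely since 2ν−1 > −1. Then there exists C > 0, depending only on ν, χ₁, χ₂, χ₃, q, such that for all h ∈ (0,1] and all x, ξ ∈ ℝ: |b(x,ξ;h) − (1/2)·χ₁(x)·χ₂(x'(x,ξ))·χ₃(x)·q(x,ξ)| ≤ C·h, where x'(x,ξ) := x + 2⟨x⟩²/(⟨x⟩²ξ − 2x) when ⟨x⟩²ξ ≠ 2x, and χ₂(x'(x,ξ)) is interpreted as 0 when ⟨x⟩²ξ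 = 2x. -/

import Mathlib

open Complex MeasureTheory Metric Set
open scoped Real

noncomputable section


/-- `⟨x⟩ = √(1+x²)`. -/
def jap (x : ℝ) : ℝ := Real.sqrt (1 + x ^ 2)

/-- `|x−y|_S = 2|x−y|/(⟨x⟩⟨y⟩)`: the chordal (circle) distance on `ℝ ≃ S¹ ∖ {pt}`. -/
def dS (x y : ℝ) : ℝ := 2 * |x - y| / (jap x * jap y)

/-- The measure `dP(x) = 2⟨x⟩⁻² dx` on `ℝ`. -/
def muP : Measure ℝ := (volume : Measure ℝ).withDensity fun x => ENNReal.ofReal (2 / (1 + x ^ 2))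

/-- `t^w := exp(w log t)` for real `t` and complex `w` (junk value `exp 0 = 1` at `t = 0`). -/
def cpowR (t : ℝ) (w : ℂ) : ℂ := Complex.exp (w * Real.log t)

/-- The operator `B(s)`: `(B(s)f)(x) = |Im s/(2π)|^{1/2} ∫ |x−x'|_S^{−2s} f(x') dP(x')`
(with the junk value `0` when the integral does not converge absolutely). -/
def Bop (s : ℂ) (f : ℝ → ℂ) (x : ℝ) : ℂ :=
  ((Real.sqrt (|s.im| / (2 * π)) : ℝ) : ℂ) * ∫ y, cpowR (dS x y) (-2 * s) * f y ∂muP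

/-- `|γ'(x)|` for the real Möbius transformation of `g` (junk at the pole). -/
def dMobR (g : Matrix.SpecialLinearGroup (Fin 2) ℝ) (x : ℝ) : ℝ := ((g.1 1 0 * x + g.1 1 1)⁻¹) ^ 2


/-- The conjugate `A ↦ ∂_y((y-x)(y-z) A)` of integration by parts in the last variable, for
amplitudes `A(x, ξ, z, y)`. -/
def transposedField (A : ℝ × ℝ × ℝ × ℝ → ℂ) (p : ℝ × ℝ × ℝ × ℝ) : ℂ :=
  fderiv ℝ (fun p : ℝ × ℝ × ℝ × ℝ =>
    (((p.2.2.2 - p.1) * (p.2.2.2 - p.2.2.1) : ℝ) : ℂ) * A p) p (0, 0, 0, 1)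

theorem contDiff_discriminant_mul {A : ℝ × ℝ × ℝ × ℝ → ℂ} (hA : ContDiff ℝ (⊤ : ℕ∞) A) :
    ContDiff ℝ (⊤ : ℕ∞) (fun p : ℝ × ℝ × ℝ × ℝ =>
      (((p.2.2.2 - p.1) * (p.2.2.2 - p.2.2.1) : ℝ) : ℂ) * A p) := by
  have h : ContDiff ℝ (⊤ : ℕ∞) (fun p : ℝ × ℝ × ℝ × ℝ =>
      (p.2.2.2 - p.1) * (p.2.2.2 - p.2.2.1)) := by fun_prop
  exact (Complex.ofRealCLM.contDiff.comp h).mul hA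

theorem contDiff_transposedField {A : ℝ × ℝ × ℝ × ℝ → ℂ} (hA : ContDiff ℝ (⊤ : ℕ∞) A) :
    ContDiff ℝ (⊤ : ℕ∞) (transposedField A) :=
  ((contDiff_discriminant_mul hA).fderiv_right (m := (⊤ : ℕ∞)) (by simp)).clm_apply
    contDiff_const

theorem tsupport_transposedField_subset (A : ℝ × ℝ × ℝ × ℝ → ℂ) :
    tsupport (transposedField A) ⊆ tsupport A :=
  (tsupport_fderiv_apply_subset ℝ _).trans (tsupport_mul_subset_right)

theorem hasCompactSupport_slice {A : ℝ × ℝ × ℝ × ℝ → ℂ} (hAc : HasCompactSupport A)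
    (x ξ z : ℝ) : HasCompactSupport fun y => A (x, ξ, z, y) := by
  refine HasCompactSupport.intro
    (hAc.isCompact.image (f := fun p : ℝ × ℝ × ℝ × ℝ => p.2.2.2) (by fun_prop)) ?_
  intro y hy
  by_contra h
  exact hy ⟨(x, ξ, z, y), subset_tsupport _ h, rfl⟩

theorem integrable_exp_mul_slice {A : ℝ × ℝ × ℝ × ℝ → ℂ} (hA : Continuous A)
    (hAc : HasCompactSupport A) {φ : ℝ → ℝ} (hφ : Measurable φ) (x ξ z : ℝ) :
    Integrable fun y => Complex.exp (I * φ y) * A (x, ξ, z, y) := by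
  refine Integrable.bdd_mul (c := 1) ?_ (Measurable.aestronglyMeasurable (by fun_prop))
    (Filter.Eventually.of_forall fun y => (norm_exp_I_mul_ofReal _).le)
  exact Continuous.integrable_of_hasCompactSupport (by fun_prop) (hasCompactSupport_slice hAc x ξ z)

theorem integral_exp_mul_transposedField {A : ℝ × ℝ × ℝ × ℝ → ℂ} (hA : ContDiff ℝ (⊤ : ℕ∞) A)
    (hAc : HasCompactSupport A) {φ : ℝ → ℝ} (hφm : Measurable φ) {x ξ z c : ℝ}
    (hD : ∀ y, (x, ξ, z, y) ∈ tsupport A → (y - x) * (y - z) ≠ 0)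
    (hφ : ∀ y, (x, ξ, z, y) ∈ tsupport A → HasDerivAt φ (c / ((y - x) * (y - z))) y) :
    ∫ y, Complex.exp (I * φ y) * transposedField A (x, ξ, z, y) =
      -(I * c) * ∫ y, Complex.exp (I * φ y) * A (x, ξ, z, y) := by
  have hTc : HasCompactSupport (transposedField A) :=
    hAc.mono' (subset_tsupport _ |>.trans (tsupport_transposedField_subset A))
  have hDA := contDiff_discriminant_mul hA
  have hderiv : ∀ y, HasDerivAt
      (fun y => Complex.exp (I * φ y) * ((((y - x) * (y - z) : ℝ) : ℂ) * A (x, ξ, z, y)))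
      (I * c * (Complex.exp (I * φ y) * A (x, ξ, z, y)) +
        Complex.exp (I * φ y) * transposedField A (x, ξ, z, y)) y := by
    intro y
    by_cases hy : (x, ξ, z, y) ∈ tsupport A
    · have h1 : HasDerivAt (fun y => Complex.exp (I * φ y))
          (Complex.exp (I * φ y) * (I * ((c / ((y - x) * (y - z)) : ℝ) : ℂ))) y :=
        (((hφ y hy).ofReal_comp).const_mul I).cexp
      have h2 : HasDerivAt (fun y => (((y - x) * (y - z) : ℝ) : ℂ) * A (x, ξ, z, y))
          (transposedField A (x, ξ, z, y)) y := by
        have h3 : HasFDerivAt (fun p : ℝ × ℝ × ℝ × ℝ =>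
            (((p.2.2.2 - p.1) * (p.2.2.2 - p.2.2.1) : ℝ) : ℂ) * A p) _ (x, ξ, z, y) :=
          (hDA.differentiable (by simp)).differentiableAt.hasFDerivAt
        have h4 : HasDerivAt (fun y : ℝ => (x, ξ, z, y)) (0, 0, 0, 1) y :=
          (hasDerivAt_const y x).prodMk ((hasDerivAt_const y ξ).prodMk
            ((hasDerivAt_const y z).prodMk (hasDerivAt_id y)))
        exact h3.comp_hasDerivAt y h4
      refine (h1.mul h2).congr_deriv ?_
      have h5 : (((y - x) * (y - z) : ℝ) : ℂ) ≠ 0 := by exact_mod_cast hD y hy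
      rw [ofReal_div]
      field_simp
    · have hev : ∀ᶠ p in nhds (x, ξ, z, y), A p = 0 := by
        rw [notMem_tsupport_iff_eventuallyEq] at hy
        exact hy
      have hev' : ∀ᶠ y' in nhds y, A (x, ξ, z, y') = 0 :=
        (Continuous.tendsto (f := fun y' : ℝ => (x, ξ, z, y')) (by fun_prop) y).eventually hev
      have hT : transposedField A (x, ξ, z, y) = 0 := by
        by_contra h
        exact hy (tsupport_transposedField_subset A (subset_tsupport _ h))
      rw [hT, hev.self_of_nhds]
      simp only [mul_zero, add_zero]
      refine (hasDerivAt_const y (0 : ℂ)).congr_of_eventuallyEq ?_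
      filter_upwards [hev'] with y' hy'
      simp [hy']
  have i1 := integrable_exp_mul_slice hA.continuous hAc hφm x ξ z
  have i2 := integrable_exp_mul_slice (contDiff_transposedField hA).continuous hTc hφm x ξ z
  have i3 := integrable_exp_mul_slice hDA.continuous (hAc.mul_left) hφm x ξ z
  have h0 := integral_eq_zero_of_hasDerivAt_of_integrable hderiv ((i1.const_mul _).add i2) i3
  rw [integral_add (i1.const_mul _) i2, integral_const_mul] at h0
  linear_combination h0

/-- The phase `(2 log|(y-z)/(y-x)| - log((1+z²)/(1+x²)))/h + tξ` at `z = x + ht`. -/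
def scaledPhase (h t x ξ y : ℝ) : ℝ :=
  t * ξ + (2 * Real.log (y - (x + h * t)) - 2 * Real.log (y - x)
    - Real.log (1 + (x + h * t) ^ 2) + Real.log (1 + x ^ 2)) / h

/-- The limit of `scaledPhase` as `h → 0`. -/
def limitPhase (t x ξ y : ℝ) : ℝ := t * ξ - 2 * t / (y - x) - 2 * t * x / (1 + x ^ 2)

theorem hasDerivAt_scaledPhase {h t x ξ y : ℝ} (hh : h ≠ 0)
    (hD : (y - x) * (y - (x + h * t)) ≠ 0) :
    HasDerivAt (scaledPhase h t x ξ) (2 * t / ((y - x) * (y - (x + h * t)))) y := by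
  obtain ⟨h1, h2⟩ := mul_ne_zero_iff.mp hD
  have d1 : HasDerivAt (fun y => Real.log (y - (x + h * t))) (1 / (y - (x + h * t))) y :=
    ((hasDerivAt_id y).sub_const _).log h2
  have d2 : HasDerivAt (fun y => Real.log (y - x)) (1 / (y - x)) y :=
    ((hasDerivAt_id y).sub_const _).log h1
  refine ((((((d1.const_mul 2).sub (d2.const_mul 2)).sub_const
    (Real.log (1 + (x + h * t) ^ 2))).add_const (Real.log (1 + x ^ 2))).div_const h).const_add
    (t * ξ)).congr_deriv ?_
  field_simp
  ring

theorem hasDerivAt_limitPhase {t x ξ y : ℝ} (hD : (y - x) * (y - x) ≠ 0) :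
    HasDerivAt (limitPhase t x ξ) (2 * t / ((y - x) * (y - x))) y := by
  have h1 : y - x ≠ 0 := (mul_ne_zero_iff.mp hD).1
  have d : HasDerivAt (fun y => 2 * t / (y - x)) _ y :=
    (hasDerivAt_const y (2 * t)).div ((hasDerivAt_id y).sub_const x) h1
  refine ((d.const_sub (t * ξ)).sub_const (2 * t * x / (1 + x ^ 2))).congr_deriv ?_
  simp
  field_simp

theorem measurable_scaledPhase (h t x ξ : ℝ) : Measurable (scaledPhase h t x ξ) := by
  unfold scaledPhase
  fun_prop

theorem measurable_limitPhase (t x ξ : ℝ) : Measurable (limitPhase t x ξ) := by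
  unfold limitPhase
  fun_prop

theorem abs_log_one_add_sq_sub_le (x w : ℝ) :
    |Real.log (1 + (x + w) ^ 2) - Real.log (1 + x ^ 2) - 2 * w * x / (1 + x ^ 2)| ≤ 3 * w ^ 2 := by
  have hx : 0 < 1 + x ^ 2 := by positivity
  have hz : 0 < 1 + (x + w) ^ 2 := by positivity
  have hw := sq_nonneg w
  rw [← Real.log_div hz.ne' hx.ne', abs_le]
  constructor
  · have h1 := Real.one_sub_inv_le_log_of_pos (div_pos hz hx)
    rw [inv_div] at h1
    have h2 : 1 - (1 + x ^ 2) / (1 + (x + w) ^ 2) - 2 * w * x / (1 + x ^ 2) =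
        w ^ 2 * ((1 + x ^ 2) - 2 * x * (2 * x + w)) / ((1 + x ^ 2) * (1 + (x + w) ^ 2)) := by
      field_simp
      ring
    have h3 : -(3 * w ^ 2) ≤
        w ^ 2 * ((1 + x ^ 2) - 2 * x * (2 * x + w)) / ((1 + x ^ 2) * (1 + (x + w) ^ 2)) := by
      rw [le_div_iff₀ (by positivity)]
      have : -3 * ((1 + x ^ 2) * (1 + (x + w) ^ 2)) ≤ (1 + x ^ 2) - 2 * x * (2 * x + w) := by
        nlinarith [sq_nonneg (x - (x + w)), sq_nonneg (x * (x + w)), sq_nonneg x,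
          sq_nonneg (x + (x + w)), sq_nonneg (x + w)]
      nlinarith
    linarith
  · have h1 := Real.log_le_sub_one_of_pos (div_pos hz hx)
    have h2 : (1 + (x + w) ^ 2) / (1 + x ^ 2) - 1 - 2 * w * x / (1 + x ^ 2) =
        w ^ 2 / (1 + x ^ 2) := by
      field_simp
      ring
    have h3 : w ^ 2 / (1 + x ^ 2) ≤ w ^ 2 := div_le_self hw (by nlinarith)
    linarith

theorem abs_log_sub_log_add_div_le {δ u w : ℝ} (hδ : 0 < δ) (hu : δ ≤ |u|) (hv : δ ≤ |u - w|) :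
    |Real.log (u - w) - Real.log u + w / u| ≤ 2 * w ^ 2 / δ ^ 2 := by
  have hu0 : u ≠ 0 := abs_pos.mp (hδ.trans_le hu)
  have hv0 : u - w ≠ 0 := abs_pos.mp (hδ.trans_le hv)
  have huv : δ ^ 2 ≤ |u| * |u - w| := by nlinarith
  have huu : δ ^ 2 ≤ u ^ 2 := by rw [← sq_abs u]; nlinarith
  have hδ2 : 0 < δ ^ 2 := by positivity
  rw [← Real.log_div hv0 hu0]
  have hr : (u - w) / u ≠ 0 := div_ne_zero hv0 hu0
  have hl : Real.log ((u - w) / u) ≤ |(u - w) / u| - 1 := by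
    rw [← Real.log_abs]; exact Real.log_le_sub_one_of_pos (abs_pos.mpr hr)
  have hl' : 1 - |u / (u - w)| ≤ Real.log ((u - w) / u) := by
    rw [← Real.log_abs, ← inv_div, abs_inv]
    exact Real.one_sub_inv_le_log_of_pos (abs_pos.mpr hr)
  have hw := sq_nonneg w
  have hB : w ^ 2 / δ ^ 2 ≤ 2 * w ^ 2 / δ ^ 2 := by gcongr; linarith
  have hB0 : 0 ≤ w ^ 2 / δ ^ 2 := by positivity
  have hvv : δ ^ 2 ≤ (u - w) ^ 2 := by rw [← sq_abs (u - w)]; nlinarith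
  rcases hr.lt_or_gt with hneg | hpos
  · have huvneg : u * (u - w) < 0 := by
      have := mul_neg_of_pos_of_neg (pow_pos (abs_pos.mpr hu0) 2) hneg
      rw [sq_abs] at this
      field_simp at this
      linarith
    rw [abs_of_neg hneg] at hl
    rw [abs_of_neg (by rw [← inv_div]; exact inv_lt_zero.mpr hneg)] at hl'
    rw [abs_le]
    constructor
    · have e : 1 - -(u / (u - w)) + w / u = 2 + u * (u - w) / (u - w) ^ 2 - (u - w) / u := by
        field_simp
        ring
      have h1 : -(w ^ 2 / δ ^ 2) ≤ u * (u - w) / (u - w) ^ 2 := by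
        rw [neg_le, ← neg_div]
        gcongr
        nlinarith
      linarith
    · have e : -((u - w) / u) - 1 + w / u = 2 * (-(u * (u - w))) / u ^ 2 := by
        field_simp
        ring
      have h1 : 2 * (-(u * (u - w))) / u ^ 2 ≤ 2 * w ^ 2 / δ ^ 2 := by
        gcongr
        nlinarith
      linarith
  · have huvpos : 0 < u * (u - w) := by
      have := mul_pos (pow_pos (abs_pos.mpr hu0) 2) hpos
      rw [sq_abs] at this
      field_simp at this
      linarith
    rw [abs_of_pos hpos] at hl
    rw [abs_of_pos (by rw [← inv_div]; exact inv_pos.mpr hpos)] at hl'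
    rw [abs_le]
    constructor
    · have e : 1 - u / (u - w) + w / u = -(w ^ 2 / (u * (u - w))) := by
        field_simp
        ring
      have h1 : w ^ 2 / (u * (u - w)) ≤ w ^ 2 / δ ^ 2 := by
        rw [← abs_mul, abs_of_pos huvpos] at huv
        gcongr
      linarith
    · have e : (u - w) / u - 1 + w / u = 0 := by
        field_simp
        ring
      linarith

theorem abs_scaledPhase_sub_limitPhase_le {δ h t x ξ y : ℝ} (hδ : 0 < δ) (hh : 0 < h)
    (h1 : δ ≤ |y - x|) (h2 : δ ≤ |y - (x + h * t)|) :
    |scaledPhase h t x ξ y - limitPhase t x ξ y| ≤ (4 / δ ^ 2 + 3) * (t ^ 2 * h) := by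
  have e : scaledPhase h t x ξ y - limitPhase t x ξ y =
      (2 * (Real.log (y - x - h * t) - Real.log (y - x) + h * t / (y - x)) -
        (Real.log (1 + (x + h * t) ^ 2) - Real.log (1 + x ^ 2)
          - 2 * (h * t) * x / (1 + x ^ 2))) / h := by
    unfold scaledPhase limitPhase
    rw [sub_sub y x]
    field_simp
    ring
  rw [← sub_sub] at h2
  have b1 := abs_le.mp (abs_log_sub_log_add_div_le hδ h1 h2)
  have b2 := abs_le.mp (abs_log_one_add_sq_sub_le x (h * t))
  have e2 : (4 / δ ^ 2 + 3) * (t ^ 2 * h) * h =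
      2 * (2 * (h * t) ^ 2 / δ ^ 2) + 3 * (h * t) ^ 2 := by ring
  rw [e, abs_div, abs_of_pos hh, div_le_iff₀ hh, e2, abs_le]
  constructor <;> linarith

theorem norm_exp_I_mul_sub_le (a b : ℝ) :
    ‖Complex.exp (I * a) - Complex.exp (I * b)‖ ≤ |a - b| := by
  have e : Complex.exp (I * a) - Complex.exp (I * b) =
      Complex.exp (I * b) * (Complex.exp (I * ((a - b : ℝ) : ℂ)) - 1) := by
    rw [mul_sub, ← Complex.exp_add, mul_one]
    congr 2
    push_cast
    ring
  rw [e, norm_mul, norm_exp_I_mul_ofReal, one_mul]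
  exact Real.norm_exp_I_mul_ofReal_sub_one_le

/-- The difference between the oscillatory integral at `z = x + ht` and its limit. -/
def oscillatoryDefect (A : ℝ × ℝ × ℝ × ℝ → ℂ) (h t x ξ : ℝ) : ℂ :=
  (∫ y, Complex.exp (I * scaledPhase h t x ξ y) * A (x, ξ, x + h * t, y)) -
    ∫ y, Complex.exp (I * limitPhase t x ξ y) * A (x, ξ, x, y)

theorem exists_norm_oscillatoryDefect_le {A : ℝ × ℝ × ℝ × ℝ → ℂ}
    (hA : ContDiff ℝ (⊤ : ℕ∞) A) (hAc : HasCompactSupport A) {δ : ℝ} (hδ : 0 < δ)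
    (hsep : ∀ x ξ z y, (x, ξ, z, y) ∈ tsupport A → δ ≤ |y - x| ∧ δ ≤ |y - z|) :
    ∃ C, 0 ≤ C ∧ ∀ h t x ξ : ℝ, 0 < h →
      ‖oscillatoryDefect A h t x ξ‖ ≤ C * ((t ^ 2 + |t|) * h) := by
  obtain ⟨M, hM⟩ := hAc.exists_bound_of_continuous hA.continuous
  obtain ⟨L, hL⟩ := hA.lipschitzWith_of_hasCompactSupport hAc (by simp)
  have hM0 : 0 ≤ M := (norm_nonneg _).trans (hM 0)
  set K := (fun p : ℝ × ℝ × ℝ × ℝ => p.2.2.2) '' tsupport A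
  have hKc : IsCompact K := hAc.isCompact.image (by fun_prop)
  set P := 4 / δ ^ 2 + 3
  have hP0 : 0 ≤ P := by positivity
  refine ⟨(P * M + L) * volume.real K, by positivity, fun h t x ξ hh => ?_⟩
  have i1 := integrable_exp_mul_slice hA.continuous hAc (measurable_scaledPhase h t x ξ)
    x ξ (x + h * t)
  have i2 := integrable_exp_mul_slice hA.continuous hAc (measurable_limitPhase t x ξ) x ξ x
  rw [oscillatoryDefect, ← integral_sub i1 i2]
  have hb : ∀ y, ‖Complex.exp (I * scaledPhase h t x ξ y) * A (x, ξ, x + h * t, y) -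
      Complex.exp (I * limitPhase t x ξ y) * A (x, ξ, x, y)‖ ≤
      K.indicator (fun _ => (P * M + L) * ((t ^ 2 + |t|) * h)) y := by
    intro y
    by_cases hy : y ∈ K
    · rw [indicator_of_mem hy]
      have e : Complex.exp (I * scaledPhase h t x ξ y) * A (x, ξ, x + h * t, y) -
          Complex.exp (I * limitPhase t x ξ y) * A (x, ξ, x, y) =
          (Complex.exp (I * scaledPhase h t x ξ y) - Complex.exp (I * limitPhase t x ξ y)) *
            A (x, ξ, x + h * t, y) + Complex.exp (I * limitPhase t x ξ y) *
            (A (x, ξ, x + h * t, y) - A (x, ξ, x, y)) := by ring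
      have b1 : ‖(Complex.exp (I * scaledPhase h t x ξ y) -
          Complex.exp (I * limitPhase t x ξ y)) * A (x, ξ, x + h * t, y)‖ ≤
          P * (t ^ 2 * h) * M := by
        by_cases hz : (x, ξ, x + h * t, y) ∈ tsupport A
        · rw [norm_mul]
          obtain ⟨s1, s2⟩ := hsep _ _ _ _ hz
          exact mul_le_mul ((norm_exp_I_mul_sub_le _ _).trans
            (abs_scaledPhase_sub_limitPhase_le hδ hh s1 s2)) (hM _) (norm_nonneg _)
            (by positivity)
        · rw [image_eq_zero_of_notMem_tsupport hz, mul_zero, norm_zero]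
          positivity
      have b2 : ‖Complex.exp (I * limitPhase t x ξ y) *
          (A (x, ξ, x + h * t, y) - A (x, ξ, x, y))‖ ≤ L * (|t| * h) := by
        rw [norm_mul, norm_exp_I_mul_ofReal, one_mul, ← dist_eq_norm]
        refine (hL.dist_le_mul _ _).trans (le_of_eq ?_)
        rw [Prod.dist_eq, Prod.dist_eq, Prod.dist_eq]
        simp only [dist_self, dist_self_add_left, norm_mul, Real.norm_eq_abs, abs_of_pos hh]
        have ht : 0 ≤ h * |t| := by positivity
        rw [max_eq_left ht, max_eq_right ht, max_eq_right ht]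
        ring
      rw [e]
      refine (norm_add_le _ _).trans ((add_le_add b1 b2).trans ?_)
      have p1 : 0 ≤ P * M * (|t| * h) := by positivity
      have p2 : 0 ≤ L * (t ^ 2 * h) := by positivity
      linarith
    · rw [indicator_of_notMem hy]
      have hz : ∀ z, A (x, ξ, z, y) = 0 := fun z =>
        image_eq_zero_of_notMem_tsupport fun hz => hy ⟨_, hz, rfl⟩
      simp [hz]
  refine (norm_integral_le_of_norm_le ?_ (Filter.Eventually.of_forall hb)).trans (le_of_eq ?_)
  · exact (integrable_indicator_iff hKc.measurableSet).mpr
      (integrableOn_const hKc.measure_lt_top.ne)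
  · rw [integral_indicator_const _ hKc.measurableSet, smul_eq_mul]
    ring

theorem hasCompactSupport_transposedField {A : ℝ × ℝ × ℝ × ℝ → ℂ} (hAc : HasCompactSupport A) :
    HasCompactSupport (transposedField A) :=
  hAc.mono' ((subset_tsupport _).trans (tsupport_transposedField_subset A))

theorem oscillatoryDefect_transposedField {A : ℝ × ℝ × ℝ × ℝ → ℂ}
    (hA : ContDiff ℝ (⊤ : ℕ∞) A) (hAc : HasCompactSupport A) {δ : ℝ} (hδ : 0 < δ)
    (hsep : ∀ x ξ z y, (x, ξ, z, y) ∈ tsupport A → δ ≤ |y - x| ∧ δ ≤ |y - z|)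
    {h : ℝ} (hh : 0 < h) (t x ξ : ℝ) :
    oscillatoryDefect (transposedField A) h t x ξ =
      -(I * ((2 * t : ℝ) : ℂ)) * oscillatoryDefect A h t x ξ := by
  have hD : ∀ z y, (x, ξ, z, y) ∈ tsupport A → (y - x) * (y - z) ≠ 0 := fun z y hy =>
    mul_ne_zero (abs_pos.mp (hδ.trans_le (hsep _ _ _ _ hy).1))
      (abs_pos.mp (hδ.trans_le (hsep _ _ _ _ hy).2))
  rw [oscillatoryDefect, oscillatoryDefect,
    integral_exp_mul_transposedField hA hAc (measurable_scaledPhase h t x ξ) (hD _)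
      (fun y hy => hasDerivAt_scaledPhase hh.ne' (hD _ y hy)),
    integral_exp_mul_transposedField hA hAc (measurable_limitPhase t x ξ) (hD _)
      (fun y hy => hasDerivAt_limitPhase (hD _ y hy)), mul_sub]

theorem exists_norm_oscillatoryDefect_le_inv {A : ℝ × ℝ × ℝ × ℝ → ℂ}
    (hA : ContDiff ℝ (⊤ : ℕ∞) A) (hAc : HasCompactSupport A) {δ : ℝ} (hδ : 0 < δ)
    (hsep : ∀ x ξ z y, (x, ξ, z, y) ∈ tsupport A → δ ≤ |y - x| ∧ δ ≤ |y - z|) :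
    ∃ C, 0 ≤ C ∧ ∀ h t x ξ : ℝ, 0 < h →
      ‖oscillatoryDefect A h t x ξ‖ ≤ C * h * (1 + t ^ 2)⁻¹ := by
  have step : ∀ B : ℝ × ℝ × ℝ × ℝ → ℂ, tsupport B ⊆ tsupport A →
      tsupport (transposedField B) ⊆ tsupport A := fun B hB =>
    (tsupport_transposedField_subset B).trans hB
  set A₁ := transposedField A with h1
  set A₂ := transposedField A₁ with h2
  set A₃ := transposedField A₂ with h3
  set A₄ := transposedField A₃ with h4
  have s1 : tsupport A₁ ⊆ tsupport A := step _ subset_rfl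
  have s2 : tsupport A₂ ⊆ tsupport A := step _ s1
  have s3 : tsupport A₃ ⊆ tsupport A := step _ s2
  have s4 : tsupport A₄ ⊆ tsupport A := step _ s3
  have c1 : ContDiff ℝ (⊤ : ℕ∞) A₁ := contDiff_transposedField hA
  have c2 : ContDiff ℝ (⊤ : ℕ∞) A₂ := contDiff_transposedField c1
  have c3 : ContDiff ℝ (⊤ : ℕ∞) A₃ := contDiff_transposedField c2
  have c4 : ContDiff ℝ (⊤ : ℕ∞) A₄ := contDiff_transposedField c3
  have k1 : HasCompactSupport A₁ := hasCompactSupport_transposedField hAc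
  have k2 : HasCompactSupport A₂ := hasCompactSupport_transposedField k1
  have k3 : HasCompactSupport A₃ := hasCompactSupport_transposedField k2
  have k4 : HasCompactSupport A₄ := hasCompactSupport_transposedField k3
  obtain ⟨C, hC0, hC⟩ := exists_norm_oscillatoryDefect_le hA hAc hδ hsep
  obtain ⟨C', hC0', hC'⟩ := exists_norm_oscillatoryDefect_le c4 k4 hδ
    (fun x ξ z y hp => hsep x ξ z y (s4 hp))
  refine ⟨3 * (C + C'), by positivity, fun h t x ξ hh => ?_⟩
  have b := hC h t x ξ hh
  have b' := hC' h t x ξ hh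
  rw [h4, oscillatoryDefect_transposedField c3 k3 hδ (fun x ξ z y hp => hsep x ξ z y (s3 hp)) hh,
    h3, oscillatoryDefect_transposedField c2 k2 hδ (fun x ξ z y hp => hsep x ξ z y (s2 hp)) hh,
    h2, oscillatoryDefect_transposedField c1 k1 hδ (fun x ξ z y hp => hsep x ξ z y (s1 hp)) hh,
    h1, oscillatoryDefect_transposedField hA hAc hδ hsep hh] at b'
  simp only [norm_mul, norm_neg, norm_I, one_mul, norm_real, Real.norm_eq_abs] at b'
  set N := ‖oscillatoryDefect A h t x ξ‖
  have hN : 0 ≤ N := norm_nonneg _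
  have e : |2| * |t| * (|2| * |t| * (|2| * |t| * (|2| * |t| * N))) = 16 * t ^ 4 * N := by
    rw [show t ^ 4 = |t| ^ 4 by rw [Even.pow_abs (by decide)], abs_two]
    ring
  rw [e] at b'
  have ht := sq_abs t
  have ht1 : |t| ≤ (1 + t ^ 2) / 2 := by nlinarith [sq_nonneg (|t| - 1)]
  have ht4 : (0 : ℝ) ≤ t ^ 4 := by positivity
  have key : (1 + t ^ 4) * N ≤ (C + C') * h * (3 / 2 * (1 + t ^ 2)) := by
    have u1 : (t ^ 2 + |t|) * h ≤ 3 / 2 * (1 + t ^ 2) * h := by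
      apply mul_le_mul_of_nonneg_right _ hh.le
      linarith
    have u2 := mul_le_mul_of_nonneg_left u1 (add_nonneg hC0 hC0')
    nlinarith
  rw [← div_eq_mul_inv, le_div_iff₀ (by positivity)]
  have hq : (1 + t ^ 2) ^ 2 ≤ 2 * (1 + t ^ 4) := by nlinarith [sq_nonneg (t ^ 2 - 1)]
  have v : (1 + t ^ 2) ^ 2 * N ≤ 2 * ((C + C') * h * (3 / 2 * (1 + t ^ 2))) :=
    (mul_le_mul_of_nonneg_right hq hN).trans (by linarith)
  have hpos : 0 < 1 + t ^ 2 := by positivity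
  refine le_of_mul_le_mul_left ?_ hpos
  linarith

/-- The amplitude `⟨x⟩^{1-2ν} ⟨z⟩^{2ν-1} |y-x|^{2ν-1} |y-z|^{-1-2ν}` of the composition
`B(s) B(1-s)`, up to cutoffs. -/
def kernelWeight (ν x z y : ℝ) : ℝ :=
  Real.exp ((2 * ν - 1) * Real.log (y - x) - (1 + 2 * ν) * Real.log (y - z)
    + (1 / 2 - ν) * (Real.log (1 + x ^ 2) - Real.log (1 + z ^ 2)))

/-- The compactly supported amplitude in the variables `(x, ξ, z, y)`. -/
def amplitude (ν : ℝ) (χ₁ χ₂ χ₃ : ℝ → ℝ) (q : ℝ × ℝ → ℂ) (p : ℝ × ℝ × ℝ × ℝ) : ℂ :=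
  ((χ₁ p.1 * χ₂ p.2.2.2 * χ₃ p.2.2.1 : ℝ) : ℂ) * q (p.2.2.1, p.2.1) *
    ((kernelWeight ν p.1 p.2.2.1 p.2.2.2 : ℝ) : ℂ)

section

variable {ν : ℝ} {χ₁ χ₂ χ₃ : ℝ → ℝ} {q : ℝ × ℝ → ℂ}

theorem mem_tsupport_of_mem_tsupport_amplitude {p : ℝ × ℝ × ℝ × ℝ}
    (hp : p ∈ tsupport (amplitude ν χ₁ χ₂ χ₃ q)) :
    p.1 ∈ tsupport χ₁ ∧ p.2.2.2 ∈ tsupport χ₂ ∧ p.2.2.1 ∈ tsupport χ₃ ∧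
      (p.2.2.1, p.2.1) ∈ tsupport q := by
  have hne : ∀ p ∈ Function.support (amplitude ν χ₁ χ₂ χ₃ q),
      χ₁ p.1 ≠ 0 ∧ χ₂ p.2.2.2 ≠ 0 ∧ χ₃ p.2.2.1 ≠ 0 ∧ q (p.2.2.1, p.2.1) ≠ 0 := by
    intro p hp
    simp only [amplitude, Function.mem_support, ne_eq, mul_eq_zero, ofReal_eq_zero, not_or] at hp
    tauto
  have hcl : IsClosed {p : ℝ × ℝ × ℝ × ℝ | p.1 ∈ tsupport χ₁ ∧ p.2.2.2 ∈ tsupport χ₂ ∧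
      p.2.2.1 ∈ tsupport χ₃ ∧ (p.2.2.1, p.2.1) ∈ tsupport q} := by
    refine IsClosed.inter ((isClosed_tsupport χ₁).preimage (by fun_prop))
      (IsClosed.inter ((isClosed_tsupport χ₂).preimage (by fun_prop))
      (IsClosed.inter ((isClosed_tsupport χ₃).preimage (by fun_prop))
      ((isClosed_tsupport q).preimage (by fun_prop))))
  refine closure_minimal (fun p hp => ?_) hcl hp
  obtain ⟨a, b, c, d⟩ := hne p hp
  exact ⟨subset_tsupport _ a, subset_tsupport _ b, subset_tsupport _ c, subset_tsupport _ d⟩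

theorem hasCompactSupport_amplitude (h1c : HasCompactSupport χ₁) (h2c : HasCompactSupport χ₂)
    (h3c : HasCompactSupport χ₃) (hqc : HasCompactSupport q) :
    HasCompactSupport (amplitude ν χ₁ χ₂ χ₃ q) := by
  have hq2 : IsCompact (Prod.snd '' tsupport q) := hqc.isCompact.image continuous_snd
  refine IsCompact.of_isClosed_subset
    (h1c.isCompact.prod (hq2.prod (h3c.isCompact.prod h2c.isCompact))) (isClosed_tsupport _) ?_
  intro p hp
  obtain ⟨a, b, c, d⟩ := mem_tsupport_of_mem_tsupport_amplitude hp
  exact ⟨a, ⟨_, d, rfl⟩, c, b⟩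

theorem exists_separation (h1c : HasCompactSupport χ₁) (h2c : HasCompactSupport χ₂)
    (h12 : Disjoint (tsupport χ₁) (tsupport χ₂)) (h23 : Disjoint (tsupport χ₂) (tsupport χ₃)) :
    ∃ δ > 0, (∀ x ∈ tsupport χ₁, ∀ y ∈ tsupport χ₂, δ ≤ |y - x|) ∧
      ∀ y ∈ tsupport χ₂, ∀ z ∈ tsupport χ₃, δ ≤ |y - z| := by
  obtain ⟨r, hr, hr'⟩ := Metric.exists_pos_forall_lt_edist h1c.isCompact (isClosed_tsupport χ₂) h12
  obtain ⟨s, hs, hs'⟩ := Metric.exists_pos_forall_lt_edist h2c.isCompact (isClosed_tsupport χ₃) h23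
  refine ⟨min r s, by positivity, fun x hx y hy => ?_, fun y hy z hz => ?_⟩
  · have := hr' x hx y hy
    rw [edist_nndist, ENNReal.coe_lt_coe, ← NNReal.coe_lt_coe, coe_nndist, Real.dist_eq,
      abs_sub_comm] at this
    exact (min_le_left (r : ℝ) s).trans this.le
  · have := hs' y hy z hz
    rw [edist_nndist, ENNReal.coe_lt_coe, ← NNReal.coe_lt_coe, coe_nndist, Real.dist_eq] at this
    exact (min_le_right (r : ℝ) s).trans this.le

theorem contDiffAt_kernelWeight {p : ℝ × ℝ × ℝ × ℝ} (h1 : p.2.2.2 - p.1 ≠ 0)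
    (h2 : p.2.2.2 - p.2.2.1 ≠ 0) :
    ContDiffAt ℝ (⊤ : ℕ∞)
      (fun p : ℝ × ℝ × ℝ × ℝ => kernelWeight ν p.1 p.2.2.1 p.2.2.2) p := by
  have l1 : ContDiffAt ℝ (⊤ : ℕ∞) (fun p : ℝ × ℝ × ℝ × ℝ => Real.log (p.2.2.2 - p.1)) p :=
    ContDiffAt.log (by fun_prop) h1
  have l2 : ContDiffAt ℝ (⊤ : ℕ∞) (fun p : ℝ × ℝ × ℝ × ℝ => Real.log (p.2.2.2 - p.2.2.1)) p :=
    ContDiffAt.log (by fun_prop) h2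
  have l3 : ContDiffAt ℝ (⊤ : ℕ∞) (fun p : ℝ × ℝ × ℝ × ℝ => Real.log (1 + p.1 ^ 2)) p :=
    ContDiffAt.log (by fun_prop) (by positivity)
  have l4 : ContDiffAt ℝ (⊤ : ℕ∞) (fun p : ℝ × ℝ × ℝ × ℝ => Real.log (1 + p.2.2.1 ^ 2)) p :=
    ContDiffAt.log (by fun_prop) (by positivity)
  exact (((contDiffAt_const.mul l1).sub (contDiffAt_const.mul l2)).add
    (contDiffAt_const.mul (l3.sub l4))).exp

theorem contDiff_amplitude (h1s : ContDiff ℝ (⊤ : ℕ∞) χ₁) (h2s : ContDiff ℝ (⊤ : ℕ∞) χ₂)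
    (h3s : ContDiff ℝ (⊤ : ℕ∞) χ₃) (hqs : ContDiff ℝ (⊤ : ℕ∞) q)
    (h12 : Disjoint (tsupport χ₁) (tsupport χ₂)) (h23 : Disjoint (tsupport χ₂) (tsupport χ₃)) :
    ContDiff ℝ (⊤ : ℕ∞) (amplitude ν χ₁ χ₂ χ₃ q) := by
  rw [contDiff_iff_contDiffAt]
  intro p
  by_cases hp : p ∈ tsupport (amplitude ν χ₁ χ₂ χ₃ q)
  · obtain ⟨a, b, c, -⟩ := mem_tsupport_of_mem_tsupport_amplitude hp
    have hw := contDiffAt_kernelWeight (ν := ν) (p := p)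
      (fun h => h12.le_bot ⟨a, sub_eq_zero.mp h ▸ b⟩)
      (fun h => h23.le_bot ⟨b, (sub_eq_zero.mp h).symm ▸ c⟩)
    have hχ : ContDiffAt ℝ (⊤ : ℕ∞)
        (fun p : ℝ × ℝ × ℝ × ℝ => χ₁ p.1 * χ₂ p.2.2.2 * χ₃ p.2.2.1) p := by fun_prop
    have hq : ContDiffAt ℝ (⊤ : ℕ∞)
        (fun p : ℝ × ℝ × ℝ × ℝ => q (p.2.2.1, p.2.1)) p := by fun_prop
    exact ((Complex.ofRealCLM.contDiff.contDiffAt.comp p hχ).mul hq).mul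
      (Complex.ofRealCLM.contDiff.contDiffAt.comp p hw)
  · rw [notMem_tsupport_iff_eventuallyEq] at hp
    exact contDiffAt_const.congr_of_eventuallyEq hp

end

theorem contDiff_comp_inv {χ : ℝ → ℝ} (hs : ContDiff ℝ (⊤ : ℕ∞) χ) (hc : HasCompactSupport χ)
    (x : ℝ) : ContDiff ℝ (⊤ : ℕ∞)
      (fun η : ℝ => if η = 0 then (0 : ℂ) else ((χ (x + η⁻¹) : ℝ) : ℂ)) := by
  rw [contDiff_iff_contDiffAt]
  intro η
  by_cases hη : η = 0
  · subst hη
    obtain ⟨R, hR⟩ := hc.isCompact.isBounded.subset_closedBall x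
    have hev : ∀ᶠ η : ℝ in nhds 0, |η| < (|R| + 1)⁻¹ := by
      have := Metric.ball_mem_nhds (0 : ℝ) (ε := (|R| + 1)⁻¹) (by positivity)
      filter_upwards [this] with η hη
      simpa using hη
    refine (contDiffAt_const (c := (0 : ℂ))).congr_of_eventuallyEq ?_
    filter_upwards [hev] with η hη
    split_ifs with h0
    · rfl
    · suffices hn : x + η⁻¹ ∉ tsupport χ by
        rw [image_eq_zero_of_notMem_tsupport hn, ofReal_zero]
      intro hmem
      have h1 := hR hmem
      rw [mem_closedBall, Real.dist_eq, add_sub_cancel_left, abs_inv] at h1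
      have h2 := (lt_inv_comm₀ (abs_pos.mpr h0) (by positivity)).mp hη
      linarith [le_abs_self R]
  · have hf : ContDiffAt ℝ (⊤ : ℕ∞) (fun η : ℝ => χ (x + η⁻¹)) η :=
      ContDiffAt.comp η hs.contDiffAt (contDiffAt_const.add (contDiffAt_inv ℝ hη))
    refine (Complex.ofRealCLM.contDiff.contDiffAt.comp η hf).congr_of_eventuallyEq ?_
    filter_upwards [isOpen_ne.mem_nhds hη] with η' hη'
    exact if_neg hη'

theorem hasCompactSupport_comp_inv {χ : ℝ → ℝ} {x : ℝ} (hx : x ∉ tsupport χ) :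
    HasCompactSupport (fun η : ℝ => if η = 0 then (0 : ℂ) else ((χ (x + η⁻¹) : ℝ) : ℂ)) := by
  obtain ⟨ε, hε, hball⟩ := Metric.isOpen_iff.mp (isClosed_tsupport χ).isOpen_compl x hx
  refine HasCompactSupport.intro (isCompact_closedBall (0 : ℝ) ε⁻¹) fun η hη => ?_
  rw [mem_closedBall_zero_iff, not_le, Real.norm_eq_abs] at hη
  split_ifs with h0
  · rfl
  · suffices hn : x + η⁻¹ ∉ tsupport χ by
      rw [image_eq_zero_of_notMem_tsupport hn, ofReal_zero]
    refine hball ?_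
    rw [Metric.mem_ball, Real.dist_eq, add_sub_cancel_left, abs_inv]
    exact inv_lt_of_inv_lt₀ hε hη

/-- The substitution `η = 1 / (y - x)`. -/
theorem integral_comp_inv_sub (x : ℝ) (G : ℝ → ℂ) :
    ∫ y, G y = ∫ η, ((η ^ 2)⁻¹ : ℝ) • G (x + η⁻¹) := by
  have himg : (fun η : ℝ => x + η⁻¹) '' {0}ᶜ = {x}ᶜ := by
    ext y
    simp only [mem_image, mem_compl_iff, mem_singleton_iff]
    constructor
    · rintro ⟨η, hη, rfl⟩ h
      exact inv_ne_zero hη (by linarith)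
    · intro hy
      exact ⟨(y - x)⁻¹, inv_ne_zero (sub_ne_zero.mpr hy), by simp⟩
  have h := integral_image_eq_integral_abs_deriv_smul (s := ({0}ᶜ : Set ℝ))
    (f := fun η => x + η⁻¹) (f' := fun η => -(η ^ 2)⁻¹) (measurableSet_singleton 0).compl
    (fun η hη => ((hasDerivAt_inv hη).const_add x).hasDerivWithinAt)
    (fun a _ b _ hab => by simpa using hab) G
  rw [himg, restrict_compl_singleton, restrict_compl_singleton] at h
  rw [h]
  refine integral_congr_ae (Filter.Eventually.of_forall fun η => ?_)
  simp only [abs_neg]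
  rw [abs_of_nonneg (by positivity)]

theorem kernelWeight_self {ν x y : ℝ} (hy : y - x ≠ 0) :
    kernelWeight ν x x y = ((y - x) ^ 2)⁻¹ := by
  have e : (2 * ν - 1) * Real.log (y - x) - (1 + 2 * ν) * Real.log (y - x)
      + (1 / 2 - ν) * (Real.log (1 + x ^ 2) - Real.log (1 + x ^ 2)) =
      -Real.log ((y - x) ^ 2) := by
    rw [Real.log_pow]
    push_cast
    ring
  rw [kernelWeight, e, Real.exp_neg, Real.exp_log (by positivity)]

open FourierTransform in
theorem integral_limitPhase_eq_fourier (ν : ℝ) (χ₁ χ₂ χ₃ : ℝ → ℝ) (q : ℝ × ℝ → ℂ) (t x ξ : ℝ) :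
    ∫ y, Complex.exp (I * limitPhase t x ξ y) * amplitude ν χ₁ χ₂ χ₃ q (x, ξ, x, y) =
      ((χ₁ x * χ₃ x : ℝ) : ℂ) * q (x, ξ) *
        (Complex.exp (((2 * π * (t / π * ((ξ - 2 * x / (1 + x ^ 2)) / 2)) : ℝ) : ℂ) * I) *
          𝓕 (fun η : ℝ => if η = 0 then (0 : ℂ) else ((χ₂ (x + η⁻¹) : ℝ) : ℂ)) (t / π)) := by
  rw [integral_comp_inv_sub x, Real.fourier_real_eq_integral_exp_smul, ← integral_const_mul,
    ← integral_const_mul]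
  refine integral_congr_ae (Filter.Eventually.of_forall fun η => ?_)
  by_cases hη : η = 0
  · simp [hη]
  · have hw := kernelWeight_self (ν := ν) (x := x) (y := x + η⁻¹)
      (by rw [add_sub_cancel_left]; exact inv_ne_zero hη)
    simp only [if_neg hη, amplitude, hw, add_sub_cancel_left, real_smul, smul_eq_mul]
    have e : Complex.exp (I * limitPhase t x ξ (x + η⁻¹)) =
        Complex.exp (((2 * π * (t / π * ((ξ - 2 * x / (1 + x ^ 2)) / 2)) : ℝ) : ℂ) * I) *
          Complex.exp (((-2 * π * η * (t / π) : ℝ) : ℂ) * I) := by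
      rw [← Complex.exp_add, ← add_mul, ← ofReal_add, mul_comm I]
      congr 3
      have := Real.pi_ne_zero
      simp only [limitPhase, add_sub_cancel_left, div_inv_eq_mul]
      field_simp
      ring
    rw [e]
    have hη' : (η : ℂ) ≠ 0 := ofReal_ne_zero.mpr hη
    push_cast
    field_simp

open FourierTransform in
theorem integral_limitPhase {χ₂ : ℝ → ℝ} (h2s : ContDiff ℝ (⊤ : ℕ∞) χ₂)
    (h2c : HasCompactSupport χ₂) {x : ℝ} (hx : x ∉ tsupport χ₂) (ν : ℝ) (χ₁ χ₃ : ℝ → ℝ)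
    (q : ℝ × ℝ → ℂ) (ξ : ℝ) :
    Integrable (fun t => ∫ y, Complex.exp (I * limitPhase t x ξ y) *
      amplitude ν χ₁ χ₂ χ₃ q (x, ξ, x, y)) ∧
    ∫ t, ∫ y, Complex.exp (I * limitPhase t x ξ y) * amplitude ν χ₁ χ₂ χ₃ q (x, ξ, x, y) =
      π * (((χ₁ x * χ₃ x : ℝ) : ℂ) * q (x, ξ) *
        if (ξ - 2 * x / (1 + x ^ 2)) / 2 = 0 then 0
        else ((χ₂ (x + ((ξ - 2 * x / (1 + x ^ 2)) / 2)⁻¹) : ℝ) : ℂ)) := by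
  set κ := (ξ - 2 * x / (1 + x ^ 2)) / 2
  set m : ℝ → ℂ := fun η => if η = 0 then (0 : ℂ) else ((χ₂ (x + η⁻¹) : ℝ) : ℂ) with hm
  have hms : ContDiff ℝ (⊤ : ℕ∞) m := contDiff_comp_inv h2s h2c x
  have hmc : HasCompactSupport m := hasCompactSupport_comp_inv hx
  have hFm : Integrable (𝓕 m) := (𝓕 (hmc.toSchwartzMap hms)).integrable
  have hexp : Integrable fun τ : ℝ => Complex.exp (((2 * π * (τ * κ) : ℝ) : ℂ) * I) * 𝓕 m τ := by
    refine hFm.bdd_mul (c := 1) (Continuous.aestronglyMeasurable (by fun_prop)) ?_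
    exact Filter.Eventually.of_forall fun τ => (norm_exp_ofReal_mul_I _).le
  simp_rw [integral_limitPhase_eq_fourier]
  refine ⟨(hexp.comp_div Real.pi_ne_zero).const_mul _, ?_⟩
  have hinv := congrFun (hms.continuous.fourierInv_fourier_eq
    (hms.continuous.integrable_of_hasCompactSupport hmc) hFm) κ
  rw [Real.fourierInv_eq'] at hinv
  rw [integral_const_mul, Measure.integral_comp_div
    (fun τ : ℝ => Complex.exp (((2 * π * (τ * κ) : ℝ) : ℂ) * I) * 𝓕 m τ) π]
  have hk : ∫ τ : ℝ, Complex.exp (((2 * π * (τ * κ) : ℝ) : ℂ) * I) * 𝓕 m τ = m κ := by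
    rw [← hinv]
    refine integral_congr_ae (Filter.Eventually.of_forall fun τ => ?_)
    simp [mul_comm]
  rw [hk, abs_of_pos Real.pi_pos, real_smul, hm]
  ring

theorem integral_muP (f : ℝ → ℂ) : ∫ y, f y ∂muP = ∫ y, ((2 / (1 + y ^ 2) : ℝ) : ℂ) * f y := by
  rw [muP, integral_withDensity_eq_integral_toReal_smul (by fun_prop) (by simp)]
  refine integral_congr_ae (Filter.Eventually.of_forall fun y => ?_)
  simp only []
  rw [ENNReal.toReal_ofReal (by positivity), real_smul]

theorem log_dS {x y : ℝ} (hxy : x ≠ y) : Real.log (dS x y) =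
    Real.log 2 + Real.log (y - x) - Real.log (1 + x ^ 2) / 2 - Real.log (1 + y ^ 2) / 2 := by
  have h1 : |y - x| ≠ 0 := abs_ne_zero.mpr (sub_ne_zero.mpr hxy.symm)
  have hx : jap x ≠ 0 := (Real.sqrt_pos.mpr (by positivity)).ne'
  have hy : jap y ≠ 0 := (Real.sqrt_pos.mpr (by positivity)).ne'
  rw [dS, abs_sub_comm, Real.log_div (by positivity) (mul_ne_zero hx hy), Real.log_mul two_ne_zero h1,
    Real.log_mul hx hy, Real.log_abs, jap, jap, Real.log_sqrt (by positivity),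
    Real.log_sqrt (by positivity)]
  ring

theorem kernel_mul_kernel_eq {ν h x y z : ℝ} (ξ : ℝ) (hh : h ≠ 0) (hxy : x ≠ y) (hyz : y ≠ z) :
    Complex.exp (-(I * x * ξ) / h) *
      ((((2 / (1 + y ^ 2) : ℝ) : ℂ) * cpowR (dS x y) (-2 * (1 / 2 - ν + I / h))) *
        ((((2 / (1 + z ^ 2) : ℝ) : ℂ) * cpowR (dS y z) (-2 * (1 - (1 / 2 - ν + I / h)))) *
          Complex.exp (I * z * ξ / h))) =
      Complex.exp (I * scaledPhase h ((z - x) / h) x ξ y) *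
        ((kernelWeight ν x z y : ℝ) : ℂ) := by
  have hd : ∀ u : ℝ, ((2 / (1 + u ^ 2) : ℝ) : ℂ) =
      Complex.exp (((Real.log 2 - Real.log (1 + u ^ 2) : ℝ) : ℂ)) := fun u => by
    rw [← ofReal_exp, Real.exp_sub, Real.exp_log two_pos, Real.exp_log (by positivity)]
  have hz : x + h * ((z - x) / h) = z := by field_simp; ring
  have hlog : Real.log (z - y) = Real.log (y - z) := by
    rw [← Real.log_abs, abs_sub_comm, Real.log_abs]
  have hh' : (h : ℂ) ≠ 0 := ofReal_ne_zero.mpr hh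
  rw [hd, hd, cpowR, cpowR, log_dS hxy, log_dS hyz, scaledPhase, kernelWeight, hz, hlog, ofReal_exp]
  simp only [← Complex.exp_add]
  congr 1
  generalize Real.log (y - x) = a
  generalize Real.log (y - z) = b
  generalize Real.log (1 + x ^ 2) = c
  generalize Real.log (1 + y ^ 2) = d
  generalize Real.log (1 + z ^ 2) = e
  push_cast
  field_simp
  ring

section

variable {ν : ℝ} {χ₁ χ₂ χ₃ : ℝ → ℝ} {q : ℝ × ℝ → ℂ}

theorem integrable_exp_scaledPhase_mul_amplitude
    (hA : ContDiff ℝ (⊤ : ℕ∞) (amplitude ν χ₁ χ₂ χ₃ q))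
    (hAc : HasCompactSupport (amplitude ν χ₁ χ₂ χ₃ q)) (h x ξ : ℝ) :
    Integrable (Function.uncurry fun y z =>
      Complex.exp (I * scaledPhase h ((z - x) / h) x ξ y) *
        amplitude ν χ₁ χ₂ χ₃ q (x, ξ, z, y)) (volume.prod volume) := by
  have hcont : Continuous fun p : ℝ × ℝ => amplitude ν χ₁ χ₂ χ₃ q (x, ξ, p.2, p.1) :=
    hA.continuous.comp (by fun_prop)
  have hcs : HasCompactSupport fun p : ℝ × ℝ => amplitude ν χ₁ χ₂ χ₃ q (x, ξ, p.2, p.1) := by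
    refine HasCompactSupport.intro
      (hAc.isCompact.image (f := fun p : ℝ × ℝ × ℝ × ℝ => (p.2.2.2, p.2.2.1)) (by fun_prop)) ?_
    intro p hp
    by_contra hne
    exact hp ⟨(x, ξ, p.2, p.1), subset_tsupport _ hne, rfl⟩
  refine Integrable.bdd_mul (c := 1)
    (hcont.integrable_of_hasCompactSupport (μ := volume.prod volume) hcs) ?_
    (Filter.Eventually.of_forall fun p => (norm_exp_I_mul_ofReal _).le)
  unfold scaledPhase
  exact Measurable.aestronglyMeasurable (by fun_prop)

theorem Bop_Bop_eq_integral (h12 : Disjoint (tsupport χ₁) (tsupport χ₂))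
    (h23 : Disjoint (tsupport χ₂) (tsupport χ₃))
    (hA : ContDiff ℝ (⊤ : ℕ∞) (amplitude ν χ₁ χ₂ χ₃ q))
    (hAc : HasCompactSupport (amplitude ν χ₁ χ₂ χ₃ q)) {h : ℝ} (hh : 0 < h) (x ξ : ℝ) :
    Integrable (fun t => ∫ y, Complex.exp (I * scaledPhase h t x ξ y) *
      amplitude ν χ₁ χ₂ χ₃ q (x, ξ, x + h * t, y)) ∧
    Complex.exp (-(I * x * ξ) / h) * (χ₁ x : ℂ) *
      Bop (1 / 2 - ν + I / h) (fun x' => (χ₂ x' : ℂ) *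
        Bop (1 - (1 / 2 - ν + I / h)) (fun x'' => (χ₃ x'' : ℂ) * q (x'', ξ) *
          Complex.exp (I * x'' * ξ / h)) x') x =
      (1 / (2 * π)) * ∫ t, ∫ y, Complex.exp (I * scaledPhase h t x ξ y) *
        amplitude ν χ₁ χ₂ χ₃ q (x, ξ, x + h * t, y) := by
  have hint := integrable_exp_scaledPhase_mul_amplitude hA hAc h x ξ
  set F : ℝ → ℝ → ℂ := fun y z => Complex.exp (I * scaledPhase h ((z - x) / h) x ξ y) *
    amplitude ν χ₁ χ₂ χ₃ q (x, ξ, z, y) with hF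
  have hsub : ∀ t, ∫ y, F y (x + h * t) = ∫ y, Complex.exp (I * scaledPhase h t x ξ y) *
      amplitude ν χ₁ χ₂ χ₃ q (x, ξ, x + h * t, y) := fun t => by
    simp only [hF, add_sub_cancel_left, mul_div_cancel_left₀ t hh.ne']
  simp_rw [← hsub]
  refine ⟨(hint.integral_prod_right.comp_add_left x).comp_mul_left' hh.ne', ?_⟩
  have him : |(1 / 2 - (ν : ℂ) + I / h).im| = 1 / h := by
    simp [div_ofReal_im, abs_of_pos hh]
  have him' : |(1 - (1 / 2 - (ν : ℂ) + I / h)).im| = 1 / h := by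
    simp [div_ofReal_im, abs_of_pos hh]
  have hsqrt : ((√(1 / h / (2 * π)) : ℝ) : ℂ) * ((√(1 / h / (2 * π)) : ℝ) : ℂ) =
      1 / h / (2 * π) := by
    rw [← ofReal_mul, Real.mul_self_sqrt (by positivity)]
    push_cast
    rfl
  have hswap : ∫ t, ∫ y, F y (x + h * t) = 1 / h * ∫ y, ∫ z, F y z := by
    rw [integral_integral_swap hint, Measure.integral_comp_mul_left (fun w => ∫ y, F y (x + w)) h,
      integral_add_left_eq_self (fun w => ∫ y, F y w) x, abs_of_pos (inv_pos.mpr hh), real_smul]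
    simp
  rw [hswap]
  simp only [Bop, integral_muP, him, him']
  generalize ((√(1 / h / (2 * π)) : ℝ) : ℂ) = c at hsqrt
  have key : ∀ y z : ℝ, Complex.exp (-(I * x * ξ) / h) * (χ₁ x : ℂ) *
      (((2 / (1 + y ^ 2) : ℝ) : ℂ) * (cpowR (dS x y) (-2 * (1 / 2 - ν + I / h)) * ((χ₂ y : ℂ) *
        (((2 / (1 + z ^ 2) : ℝ) : ℂ) * (cpowR (dS y z) (-2 * (1 - (1 / 2 - ν + I / h))) *
          ((χ₃ z : ℂ) * q (z, ξ) * Complex.exp (I * z * ξ / h))))))) = F y z := by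
    intro y z
    by_cases h0 : χ₁ x * χ₂ y * χ₃ z = 0
    · have h0' : (χ₁ x : ℂ) * χ₂ y * χ₃ z = 0 := by exact_mod_cast h0
      simp only [hF, amplitude, h0, ofReal_zero, zero_mul, mul_zero]
      linear_combination (Complex.exp (-(I * x * ξ) / h) * ((2 / (1 + y ^ 2) : ℝ) : ℂ) *
        cpowR (dS x y) (-2 * (1 / 2 - ν + I / h)) * ((2 / (1 + z ^ 2) : ℝ) : ℂ) *
        cpowR (dS y z) (-2 * (1 - (1 / 2 - ν + I / h))) * q (z, ξ) *
        Complex.exp (I * z * ξ / h)) * h0'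
    · have n1 : x ∈ tsupport χ₁ := subset_tsupport _ fun h => h0 (by simp [h])
      have n2 : y ∈ tsupport χ₂ := subset_tsupport _ fun h => h0 (by simp [h])
      have n3 : z ∈ tsupport χ₃ := subset_tsupport _ fun h => h0 (by simp [h])
      have := kernel_mul_kernel_eq (ν := ν) ξ hh.ne' (h12.ne_of_mem n1 n2) (h23.ne_of_mem n2 n3)
      simp only [hF, amplitude]
      rw [ofReal_mul, ofReal_mul]
      linear_combination ((χ₁ x : ℂ) * χ₂ y * χ₃ z * q (z, ξ)) * this
  simp_rw [← key, integral_const_mul]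
  have hpull : ∀ y : ℝ, ((2 / (1 + y ^ 2) : ℝ) : ℂ) * (cpowR (dS x y) (-2 * (1 / 2 - ν + I / h)) *
      ((χ₂ y : ℂ) * (c * ∫ z, ((2 / (1 + z ^ 2) : ℝ) : ℂ) *
        (cpowR (dS y z) (-2 * (1 - (1 / 2 - ν + I / h))) *
          ((χ₃ z : ℂ) * q (z, ξ) * Complex.exp (I * z * ξ / h)))))) =
      c * (((2 / (1 + y ^ 2) : ℝ) : ℂ) * (cpowR (dS x y) (-2 * (1 / 2 - ν + I / h)) *
      ((χ₂ y : ℂ) * ∫ z, ((2 / (1 + z ^ 2) : ℝ) : ℂ) *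
        (cpowR (dS y z) (-2 * (1 - (1 / 2 - ν + I / h))) *
          ((χ₃ z : ℂ) * q (z, ξ) * Complex.exp (I * z * ξ / h)))))) := fun y => by ring
  simp_rw [hpull, integral_const_mul]
  generalize (∫ y : ℝ, _ : ℂ) = J
  linear_combination (Complex.exp (-(I * x * ξ) / h) * χ₁ x * J) * hsqrt

end

/-- The symbol of `χ₁ B(s) χ₂ B(1−s) χ₃ Op_h(q)` equals
`(1/2) χ₁(x) χ₂(x'(x,ξ)) χ₃(x) q(x,ξ) + O(h)`, where `x'(x,ξ) = x + 2⟨x⟩²/(⟨x⟩²ξ − 2x)`. -/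
theorem stmt18 (ν : ℝ) (hν : ν ∈ Set.Icc (0 : ℝ) (1 / 2)) (χ₁ χ₂ χ₃ : ℝ → ℝ)
    (h1s : ContDiff ℝ (⊤ : ℕ∞) χ₁) (h1c : HasCompactSupport χ₁)
    (h2s : ContDiff ℝ (⊤ : ℕ∞) χ₂) (h2c : HasCompactSupport χ₂)
    (h3s : ContDiff ℝ (⊤ : ℕ∞) χ₃) (h3c : HasCompactSupport χ₃)
    (h12 : Disjoint (tsupport χ₁) (tsupport χ₂))
    (h23 : Disjoint (tsupport χ₂) (tsupport χ₃))
    (q : ℝ × ℝ → ℂ) (hqs : ContDiff ℝ (⊤ : ℕ∞) q) (hqc : HasCompactSupport q) :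
    ∃ C > 0, ∀ h ∈ Set.Ioc (0 : ℝ) 1, ∀ x ξ : ℝ,
      ‖Complex.exp (-(I * x * ξ) / h) * (χ₁ x : ℂ) *
            Bop (1 / 2 - ν + I / h) (fun x' => (χ₂ x' : ℂ) *
              Bop (1 - (1 / 2 - ν + I / h)) (fun x'' => (χ₃ x'' : ℂ) * q (x'', ξ) *
                Complex.exp (I * x'' * ξ / h)) x') x
          - (1 / 2 : ℂ) * (χ₁ x : ℂ) *
            (if jap x ^ 2 * ξ - 2 * x = 0 then 0
             else ((χ₂ (x + 2 * jap x ^ 2 / (jap x ^ 2 * ξ - 2 * x)) : ℝ) : ℂ)) *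
            (χ₃ x : ℂ) * q (x, ξ)‖ ≤ C * h := by
  obtain ⟨δ, hδ, hδ12, hδ23⟩ := exists_separation h1c h2c h12 h23
  have hA := contDiff_amplitude (ν := ν) h1s h2s h3s hqs h12 h23
  have hAc := hasCompactSupport_amplitude (ν := ν) h1c h2c h3c hqc
  obtain ⟨C, hC0, hC⟩ := exists_norm_oscillatoryDefect_le_inv hA hAc hδ fun x ξ z y hp => by
    obtain ⟨a, b, c, -⟩ := mem_tsupport_of_mem_tsupport_amplitude hp
    exact ⟨hδ12 x a y b, hδ23 y b z c⟩
  refine ⟨C + 1, by positivity, fun h hh x ξ => ?_⟩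
  obtain ⟨hh0, -⟩ := hh
  by_cases hx : χ₁ x = 0
  · simp only [hx, ofReal_zero, mul_zero, zero_mul, sub_zero, norm_zero]
    positivity
  have hx1 : x ∈ tsupport χ₁ := subset_tsupport _ hx
  have hx2 : x ∉ tsupport χ₂ := fun hm => h12.le_bot ⟨hx1, hm⟩
  obtain ⟨i1, e1⟩ := Bop_Bop_eq_integral h12 h23 hA hAc hh0 x ξ
  obtain ⟨i2, e2⟩ := integral_limitPhase h2s h2c hx2 ν χ₁ χ₃ q ξ
  have hpos : 0 < 1 + x ^ 2 := by positivity
  have hjap : jap x ^ 2 = 1 + x ^ 2 := Real.sq_sqrt hpos.le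
  have hκ : (ξ - 2 * x / (1 + x ^ 2)) / 2 = ((1 + x ^ 2) * ξ - 2 * x) / (2 * (1 + x ^ 2)) := by
    field_simp
  have hif : (if (ξ - 2 * x / (1 + x ^ 2)) / 2 = 0 then (0 : ℂ)
        else ((χ₂ (x + ((ξ - 2 * x / (1 + x ^ 2)) / 2)⁻¹) : ℝ) : ℂ)) =
      if jap x ^ 2 * ξ - 2 * x = 0 then 0
        else ((χ₂ (x + 2 * jap x ^ 2 / (jap x ^ 2 * ξ - 2 * x)) : ℝ) : ℂ) := by
    rw [hκ, inv_div, hjap]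
    simp only [div_eq_zero_iff, (by positivity : 2 * (1 + x ^ 2) ≠ 0), or_false]
  rw [hif] at e2
  have hmain : (1 / 2 : ℂ) * (χ₁ x : ℂ) *
      (if jap x ^ 2 * ξ - 2 * x = 0 then 0
        else ((χ₂ (x + 2 * jap x ^ 2 / (jap x ^ 2 * ξ - 2 * x)) : ℝ) : ℂ)) *
      (χ₃ x : ℂ) * q (x, ξ) = (1 / (2 * π)) * ∫ t, ∫ y, Complex.exp (I * limitPhase t x ξ y) *
        amplitude ν χ₁ χ₂ χ₃ q (x, ξ, x, y) := by
    rw [e2]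
    have := ofReal_ne_zero.mpr Real.pi_ne_zero
    push_cast
    field_simp
  rw [e1, hmain, ← mul_sub, ← integral_sub i1 i2]
  have hb : ‖∫ t, oscillatoryDefect (amplitude ν χ₁ χ₂ χ₃ q) h t x ξ‖ ≤ C * h * π := by
    refine (norm_integral_le_of_norm_le (integrable_inv_one_add_sq.const_mul (C * h))
      (Filter.Eventually.of_forall fun t => hC h t x ξ hh0)).trans (le_of_eq ?_)
    rw [integral_const_mul, integral_univ_inv_one_add_sq]
  have hn : ‖(1 / (2 * π) : ℂ)‖ = 1 / (2 * π) := by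
    simp [abs_of_pos Real.pi_pos]
  rw [norm_mul, hn]
  calc _ ≤ 1 / (2 * π) * (C * h * π) := mul_le_mul_of_nonneg_left hb (by positivity)
    _ = C * h / 2 := by field_simp
    _ ≤ (C + 1) * h := by nlinarith [mul_nonneg hC0 hh0.le]
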